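/- Let S_1,…,S_N be a representation of the Cuntz algebra 𝒪_N on ℋ, let α be a unital *-algebra endomorphism of B(ℋ), and set U_α = ∑_{i=1}^N α(S_i) S_i*. Then for every infinite word ω ∈ Ω_N, the limit projections satisfy the covariance relation α(S_{ω_1}) X(σ(ω)) α(S_{ω_1})* = U_α X(ω) U_α*, where ω_1 is the first letter of ω. -/

import Mathlib

open ContinuousLinearMap Filter Topology

/-- `S_f = S_{i₁} S_{i₂} ⋯ S_{i_k}` for a finite word `f = (i₁,…,i_k)`. -/
noncomputable def SWord {H : Type*} [NormedAddCommGroup H] [InnerProductSpace ℂ H]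
    {N : ℕ} (S : Fin N → H →L[ℂ] H) (f : List (Fin N)) : H →L[ℂ] H :=
  (f.map S).prod

/-- `P(ω|_k) = S_{ω|_k} S_{ω|_k}^*`. -/
noncomputable def cuntzProj {H : Type*} [NormedAddCommGroup H] [InnerProductSpace ℂ H]
    [CompleteSpace H] {N : ℕ} (S : Fin N → H →L[ℂ] H) (ω : ℕ → Fin N) (k : ℕ) :
    H →L[ℂ] H :=
  SWord S ((List.range k).map ω) * adjoint (SWord S ((List.range k).map ω))

/-- The one-sided shift `σ(ω) = (ω₂, ω₃, …)`. -/
def shiftWord {N : ℕ} (ω : ℕ → Fin N) : ℕ → Fin N := fun n => ω (n + 1)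

/-- For a representation of the Cuntz algebra `𝒪_N`, a unital *-algebra endomorphism
`α` of `B(ℋ)`, and `U_α = ∑_i α(S_i) S_i^*`, the limit projections satisfy the
covariance relation `α(S_{ω₁}) X(σ(ω)) α(S_{ω₁})^* = U_α X(ω) U_α^*`. -/
theorem cuntz_limit_projection_endomorphism_covariance
    {H : Type*} [NormedAddCommGroup H] [InnerProductSpace ℂ H] [CompleteSpace H]
    (N : ℕ) (hN : 2 ≤ N) (S : Fin N → H →L[ℂ] H)
    (hiso : ∀ i j, adjoint (S i) * S j = if i = j then 1 else 0)
    (hsum : ∑ i, S i * adjoint (S i) = 1)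
    (α : (H →L[ℂ] H) → (H →L[ℂ] H))
    (hadd : ∀ A B, α (A + B) = α A + α B)
    (hsmul : ∀ (c : ℂ) (A), α (c • A) = c • α A)
    (hmul : ∀ A B, α (A * B) = α A * α B)
    (hstar : ∀ A, α (adjoint A) = adjoint (α A))
    (hone : α 1 = 1)
    (X : (ℕ → Fin N) → H →L[ℂ] H)
    (hX : ∀ (ω : ℕ → Fin N) (h : H),
      Tendsto (fun k => cuntzProj S ω k h) atTop (𝓝 (X ω h))) :
    ∀ ω : ℕ → Fin N,
      α (S (ω 0)) * X (shiftWord ω) * adjoint (α (S (ω 0))) =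
        (∑ i : Fin N, α (S i) * adjoint (S i)) * X ω *
          adjoint (∑ i : Fin N, α (S i) * adjoint (S i)) := by
  intro ω
  have hU : (∑ i : Fin N, α (S i) * adjoint (S i)) * S (ω 0) = α (S (ω 0)) := by
    rw [Finset.sum_mul]
    simp only [mul_assoc, hiso]
    simp
  have hword : ∀ k, SWord S ((List.range (k + 1)).map ω)
      = S (ω 0) * SWord S ((List.range k).map (shiftWord ω)) := by
    intro k
    simp only [SWord, List.range_succ_eq_map, List.map_cons, List.prod_cons, List.map_map]
    rfl
  have hproj : ∀ k, cuntzProj S ω (k + 1)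
      = S (ω 0) * cuntzProj S (shiftWord ω) k * adjoint (S (ω 0)) := by
    intro k
    simp only [cuntzProj, hword, ← star_eq_adjoint, star_mul, mul_assoc]
  have hXω : X ω = S (ω 0) * X (shiftWord ω) * adjoint (S (ω 0)) := by
    ext h
    have h1 := (hX ω h).comp (tendsto_add_atTop_nat 1)
    have h2 := ((S (ω 0)).continuous.tendsto _).comp
      (hX (shiftWord ω) (adjoint (S (ω 0)) h))
    refine tendsto_nhds_unique h1 (h2.congr fun k => ?_)
    simp only [Function.comp_apply, hproj]
    rfl
  rw [hXω, ← hU]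
  simp only [← star_eq_adjoint, star_mul, mul_assoc]
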